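/- Let G be the complete graph on n vertices. Then the compressing information of G is at most (1/2)·(log₂(n−1) + n/(n−1)) and hence at most (1/2)·log₂ n + 1; consequently at least roughly half of the Shannon entropy log₂ n cannot be decoded by any encoding tree. -/

import Mathlib

open Finset

open scoped Classical

/-- An encoding tree over a finite vertex set `V`: a rooted tree whose nodes carry
nonempty subsets (markers) of `V`, the root carries `V`, the markers of the children
of any non-leaf node partition the node's marker, every non-leaf node has at least
two children, and leaves carry singletons. -/
structure EncTree (V : Type) [Fintype V] [DecidableEq V] : Type 1 where
  node : Type
  [fin : Fintype node]
  [deq : DecidableEq node]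
  root : node
  parent : node → node
  parent_root : parent root = root
  depth : node → ℕ
  depth_root : depth root = 0
  depth_parent : ∀ a, a ≠ root → depth a = depth (parent a) + 1
  mark : node → Finset V
  mark_root : mark root = Finset.univ
  mark_nonempty : ∀ a, (mark a).Nonempty
  mark_subset : ∀ a, a ≠ root → mark a ⊆ mark (parent a)
  children_partition : ∀ a, (∃ b, b ≠ a ∧ parent b = a) →
    ∀ x ∈ mark a, ∃! b, b ≠ a ∧ parent b = a ∧ x ∈ mark b
  children_two : ∀ a b, b ≠ a → parent b = a → ∃ c, c ≠ a ∧ c ≠ b ∧ parent c = a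
  leaf_singleton : ∀ a, (∀ b, b ≠ a → parent b ≠ a) → (mark a).card = 1

attribute [instance] EncTree.fin EncTree.deq

namespace SiLeM

variable {V : Type} [Fintype V] [DecidableEq V]

/-- A node of an encoding tree is a leaf if it has no children. -/
def IsLeaf (T : EncTree V) (a : T.node) : Prop :=
  ∀ b, b ≠ a → T.parent b ≠ a

/-- Volume of a set of vertices: total degree. -/
noncomputable def vol (G : SimpleGraph V) (A : Finset V) : ℝ :=
  ∑ v ∈ A, (G.degree v : ℝ)

/-- Volume of the graph: total degree of all vertices. -/
noncomputable def volG (G : SimpleGraph V) : ℝ := ∑ v : V, (G.degree v : ℝ)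

/-- `g_A`: the number of edges with exactly one endpoint in `A`
(counted as ordered pairs entering `A`). -/
noncomputable def ecut (G : SimpleGraph V) (A : Finset V) : ℝ :=
  ((Finset.univ.filter
      (fun p : V × V => G.Adj p.1 p.2 ∧ p.1 ∉ A ∧ p.2 ∈ A)).card : ℝ)

/-- Structural entropy of `G` given by the encoding tree `T`. -/
noncomputable def HT (G : SimpleGraph V) (T : EncTree V) : ℝ :=
  -∑ a ∈ Finset.univ.filter (fun a : T.node => a ≠ T.root),
      (ecut G (T.mark a) / volG G) *
        Real.logb 2 (vol G (T.mark a) / vol G (T.mark (T.parent a)))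

/-- One-dimensional structural entropy: Shannon entropy of the degree distribution. -/
noncomputable def H1 (G : SimpleGraph V) : ℝ :=
  -∑ v : V, ((G.degree v : ℝ) / volG G) * Real.logb 2 ((G.degree v : ℝ) / volG G)

/-- Compressing information of `G` given by the encoding tree `T`. -/
noncomputable def CT (G : SimpleGraph V) (T : EncTree V) : ℝ :=
  -∑ a ∈ Finset.univ.filter (fun a : T.node => a ≠ T.root),
      ((vol G (T.mark a) - ecut G (T.mark a)) / volG G) *
        Real.logb 2 (vol G (T.mark a) / vol G (T.mark (T.parent a)))

/-- Structural entropy of `G`: minimum over all encoding trees. -/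
noncomputable def SE (G : SimpleGraph V) : ℝ :=
  sInf {x | ∃ T : EncTree V, x = HT G T}

/-- `k`-dimensional structural entropy: minimum over encoding trees of height ≤ k. -/
noncomputable def SEk (G : SimpleGraph V) (k : ℕ) : ℝ :=
  sInf {x | ∃ T : EncTree V, (∀ a, T.depth a ≤ k) ∧ x = HT G T}

/-- Compressing information of `G`: maximum over all encoding trees. -/
noncomputable def CInfo (G : SimpleGraph V) : ℝ :=
  sSup {x | ∃ T : EncTree V, x = CT G T}

/-- `k`-dimensional compressing information. -/
noncomputable def Ck (G : SimpleGraph V) (k : ℕ) : ℝ :=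
  sSup {x | ∃ T : EncTree V, (∀ a, T.depth a ≤ k) ∧ x = CT G T}

/-- Decoding information of `G`. -/
noncomputable def DInfo (G : SimpleGraph V) : ℝ :=
  sSup {x | ∃ T : EncTree V, x = H1 G - HT G T}

/-- `k`-dimensional decoding information. -/
noncomputable def Dk (G : SimpleGraph V) (k : ℕ) : ℝ :=
  sSup {x | ∃ T : EncTree V, (∀ a, T.depth a ≤ k) ∧ x = H1 G - HT G T}

/-- Conductance of a subset `S`. -/
noncomputable def condS (G : SimpleGraph V) (S : Finset V) : ℝ :=
  ecut G S / min (vol G S) (vol G Sᶜ)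

/-- Conductance of the graph. -/
noncomputable def conductance (G : SimpleGraph V) : ℝ :=
  sInf {x | ∃ S : Finset V, S.Nonempty ∧ S ≠ Finset.univ ∧ x = condS G S}

/-- `H̃(Y = β | X = α)` for an edge `(x, y)` with codewords `α, β`: the sum is over
the nodes `δ` with `γ ⊂ δ ⊆ β` where `γ` is the longest common initial segment of
`α` and `β`; these are exactly the nodes whose marker contains `y` but not `x`. -/
noncomputable def Htilde (G : SimpleGraph V) (T : EncTree V) (x y : V) : ℝ :=
  -∑ a ∈ Finset.univ.filter (fun a : T.node => y ∈ T.mark a ∧ x ∉ T.mark a),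
      Real.logb 2 (vol G (T.mark a) / vol G (T.mark (T.parent a)))

/-- `Ĩ(X = α; Y = β)` for an edge `(x, y)`: the sum over the nodes `δ` with
`λ ⊂ δ ⊆ γ`, i.e. the non-root nodes whose marker contains both `x` and `y`. -/
noncomputable def Itilde (G : SimpleGraph V) (T : EncTree V) (x y : V) : ℝ :=
  -∑ a ∈ Finset.univ.filter
      (fun a : T.node => a ≠ T.root ∧ x ∈ T.mark a ∧ y ∈ T.mark a),
      Real.logb 2 (vol G (T.mark a) / vol G (T.mark (T.parent a)))

end SiLeM

theorem s11_vol {V : Type} [Fintype V] [DecidableEq V] (A : Finset V) (h : 1 ≤ Fintype.card V) :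
    SiLeM.vol (⊤ : SimpleGraph V) A = (A.card : ℝ) * ((Fintype.card V : ℝ) - 1) := by
  unfold SiLeM.vol
  rw [← nsmul_eq_mul]
  apply Finset.sum_eq_card_nsmul
  intro v _
  rw [← Nat.cast_one, ← Nat.cast_sub h, Nat.cast_inj]
  convert SimpleGraph.complete_graph_degree v

theorem s11_ecut {V : Type} [Fintype V] [DecidableEq V] (A : Finset V) :
    SiLeM.ecut (⊤ : SimpleGraph V) A = ((Fintype.card V : ℝ) - A.card) * (A.card : ℝ) := by
  unfold SiLeM.ecut
  rw [← Nat.cast_sub (Finset.card_le_univ A), ← Nat.cast_mul, ← Finset.card_compl,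
    ← Finset.card_product, Nat.cast_inj]
  congr 1
  ext ⟨x, y⟩
  simp only [Finset.mem_filter, Finset.mem_univ, true_and, SimpleGraph.top_adj,
    Finset.mem_product, Finset.mem_compl]
  constructor
  · exact fun h => h.2
  · intro h
    refine ⟨?_, h⟩
    rintro rfl
    exact h.1 h.2

theorem s11_ne {V : Type} [Fintype V] [DecidableEq V] (T : EncTree V) (a : T.node)
    (ha : a ≠ T.root) : a ≠ T.parent a := by
  intro h
  have := T.depth_parent a ha
  rw [← h] at this
  omega

theorem s11_ne_root {V : Type} [Fintype V] [DecidableEq V] (T : EncTree V) (a b : T.node)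
    (h : b ≠ a) (hb : T.parent b = a) : b ≠ T.root := by
  rintro rfl
  exact h (T.parent_root.symm.trans hb)

theorem s11_lt {V : Type} [Fintype V] [DecidableEq V] (T : EncTree V) (a : T.node)
    (ha : a ≠ T.root) : (T.mark a).card < (T.mark (T.parent a)).card := by
  apply Finset.card_lt_card
  refine ⟨T.mark_subset a ha, fun hsub => ?_⟩
  have hne := s11_ne T a ha
  obtain ⟨c, hc, hca, hcp⟩ := T.children_two _ a hne rfl
  obtain ⟨x, hx⟩ := T.mark_nonempty c
  have hxp : x ∈ T.mark (T.parent a) := by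
    have := T.mark_subset c (s11_ne_root T _ c hc hcp) hx
    rwa [hcp] at this
  have hu := T.children_partition (T.parent a) ⟨a, hne, rfl⟩ x hxp
  exact hca (hu.unique ⟨hc, hcp, hx⟩ ⟨hne, rfl, hsub hxp⟩)

theorem s11_children {V : Type} [Fintype V] [DecidableEq V] (T : EncTree V) (p : T.node) :
    ∑ a ∈ (Finset.univ.filter (fun a : T.node => a ≠ T.root)).filter (fun a => T.parent a = p),
      (T.mark a).card ≤ (T.mark p).card := by
  rw [← Finset.card_biUnion]
  · apply Finset.card_le_card
    intro x hx
    simp only [Finset.mem_biUnion, Finset.mem_filter, Finset.mem_univ, true_and] at hx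
    obtain ⟨a, ⟨ha, hap⟩, hxa⟩ := hx
    rw [← hap]
    exact T.mark_subset a ha hxa
  · intro a ha b hb hab
    simp only [Finset.mem_coe, Finset.mem_filter, Finset.mem_univ, true_and] at ha hb
    rw [Function.onFun, Finset.disjoint_left]
    intro x hxa hxb
    have hne := s11_ne T a ha.1
    have hne2 := s11_ne T b hb.1
    rw [ha.2] at hne
    rw [hb.2] at hne2
    have hxp : x ∈ T.mark p := by
      rw [← ha.2]; exact T.mark_subset a ha.1 hxa
    exact hab ((T.children_partition p ⟨a, hne, ha.2⟩ x hxp).unique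
      ⟨hne, ha.2, hxa⟩ ⟨hne2, hb.2, hxb⟩)

theorem s11_sum {V : Type} [Fintype V] [DecidableEq V] (T : EncTree V) :
    ∑ a ∈ Finset.univ.filter (fun a : T.node => a ≠ T.root),
      ((T.mark a).card : ℝ) * (((T.mark (T.parent a)).card : ℝ) - (T.mark a).card)
      ≤ (Fintype.card V : ℝ) ^ 2 := by
  have h1 : ∑ a ∈ Finset.univ.filter (fun a : T.node => a ≠ T.root),
      ((T.mark a).card : ℝ) * ((T.mark (T.parent a)).card : ℝ)
      ≤ ∑ p : T.node, ((T.mark p).card : ℝ) ^ 2 := by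
    rw [← Finset.sum_fiberwise (Finset.univ.filter (fun a : T.node => a ≠ T.root)) T.parent]
    apply Finset.sum_le_sum
    intro p _
    have h2 : ∑ a ∈ (Finset.univ.filter (fun a : T.node => a ≠ T.root)).filter
        (fun a => T.parent a = p), ((T.mark a).card : ℝ) * ((T.mark (T.parent a)).card : ℝ)
        = (∑ a ∈ (Finset.univ.filter (fun a : T.node => a ≠ T.root)).filter
        (fun a => T.parent a = p), ((T.mark a).card : ℝ)) * ((T.mark p).card : ℝ) := by
      rw [Finset.sum_mul]
      apply Finset.sum_congr rfl
      intro a ha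
      rw [(Finset.mem_filter.mp ha).2]
    rw [h2, sq]
    apply mul_le_mul_of_nonneg_right _ (Nat.cast_nonneg _)
    exact_mod_cast s11_children T p
  have h3 : ∑ p : T.node, ((T.mark p).card : ℝ) ^ 2 =
      ∑ a ∈ Finset.univ.filter (fun a : T.node => a ≠ T.root), ((T.mark a).card : ℝ) ^ 2
      + (Fintype.card V : ℝ) ^ 2 := by
    rw [Finset.filter_ne', ← Finset.sum_erase_add _ _ (Finset.mem_univ T.root), T.mark_root,
      Finset.card_univ]
  simp only [mul_sub, Finset.sum_sub_distrib]
  simp only [← sq]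
  linarith

theorem s11_term (n k m : ℝ) (hn : 2 ≤ n) (hk : 1 ≤ k) (hkm : k ≤ m) (hkn : k ≤ n - 1) :
    -((k * (n - 1) - (n - k) * k) / (n * (n - 1)) *
        Real.logb 2 (k * (n - 1) / (m * (n - 1))))
      ≤ (n - 2) / (n * (n - 1) ^ 2 * Real.log 2) * (k * (m - k)) := by
  have hl : 0 < Real.log 2 := Real.log_pos (by norm_num)
  have hn1 : 0 < n - 1 := by linarith
  have hn0 : 0 < n := by linarith
  have hk0 : 0 < k := by linarith
  have hm0 : 0 < m := by linarith
  have e1 : k * (n - 1) / (m * (n - 1)) = (m / k)⁻¹ := by field_simp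
  rw [e1, Real.logb_inv, Real.logb]
  have h1 := Real.log_le_sub_one_of_pos (div_pos hm0 hk0)
  have e2 : -((k * (n - 1) - (n - k) * k) / (n * (n - 1)) * -(Real.log (m / k) / Real.log 2))
      = k * (k - 1) / (n * (n - 1) * Real.log 2) * Real.log (m / k) := by
    field_simp
    ring
  rw [e2]
  have hk1 : 0 ≤ k - 1 := by linarith
  calc _ ≤ k * (k - 1) / (n * (n - 1) * Real.log 2) * (m / k - 1) :=
        mul_le_mul_of_nonneg_left h1 (by positivity)
    _ = (k - 1) * (n - 1) * ((m - k) / (n * (n - 1) ^ 2 * Real.log 2)) := by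
        field_simp
    _ ≤ k * (n - 2) * ((m - k) / (n * (n - 1) ^ 2 * Real.log 2)) := by
        have : 0 ≤ m - k := by linarith
        apply mul_le_mul_of_nonneg_right _ (by positivity)
        nlinarith
    _ = _ := by ring

theorem s11_CT {V : Type} [Fintype V] [DecidableEq V] (h : 2 ≤ Fintype.card V) (T : EncTree V) :
    SiLeM.CT (⊤ : SimpleGraph V) T ≤
      ((Fintype.card V : ℝ) - 2) * (Fintype.card V : ℝ) /
        (((Fintype.card V : ℝ) - 1) ^ 2 * Real.log 2) := by
  have hl : 0 < Real.log 2 := Real.log_pos (by norm_num)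
  have hn : (2 : ℝ) ≤ Fintype.card V := by exact_mod_cast h
  have hv : SiLeM.volG (⊤ : SimpleGraph V) = (Fintype.card V : ℝ) * ((Fintype.card V : ℝ) - 1) := by
    have := s11_vol (Finset.univ : Finset V) (by omega)
    rwa [Finset.card_univ] at this
  unfold SiLeM.CT
  rw [← Finset.sum_neg_distrib, hv]
  simp only [s11_ecut, s11_vol _ (show 1 ≤ Fintype.card V by omega)]
  have hc : 0 ≤ ((Fintype.card V : ℝ) - 2) /
      ((Fintype.card V : ℝ) * ((Fintype.card V : ℝ) - 1) ^ 2 * Real.log 2) := by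
    have : 0 ≤ (Fintype.card V : ℝ) - 2 := by linarith
    positivity
  refine (Finset.sum_le_sum (fun a ha => s11_term (Fintype.card V) ((T.mark a).card)
    ((T.mark (T.parent a)).card) hn ?_ ?_ ?_)).trans ?_
  · exact_mod_cast Finset.card_pos.mpr (T.mark_nonempty a)
  · exact_mod_cast (s11_lt T a (Finset.mem_filter.mp ha).2).le
  · have h1 := s11_lt T a (Finset.mem_filter.mp ha).2
    have h2 := Finset.card_le_univ (T.mark (T.parent a))
    have h3 : (T.mark a).card + 1 ≤ Fintype.card V := by omega
    have h4 : ((T.mark a).card : ℝ) + 1 ≤ Fintype.card V := by exact_mod_cast h3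
    linarith
  · rw [← Finset.mul_sum]
    refine (mul_le_mul_of_nonneg_left (s11_sum T) hc).trans (le_of_eq ?_)
    have : (Fintype.card V : ℝ) - 1 ≠ 0 := by linarith
    field_simp

theorem s11_num (n : ℕ) (hn : 2 ≤ n) :
    ((n : ℝ) - 2) * (n : ℝ) / (((n : ℝ) - 1) ^ 2 * Real.log 2) ≤
      (1 / 2) * (Real.logb 2 ((n : ℝ) - 1) + (n : ℝ) / ((n : ℝ) - 1)) := by
  have hl := Real.log_two_gt_d9
  have hl0 : 0 < Real.log 2 := by linarith
  rcases (by omega : n = 2 ∨ n = 3 ∨ n = 4 ∨ 5 ≤ n) with rfl | rfl | rfl | h5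
  · norm_num
  · have : Real.logb 2 (((3 : ℕ) : ℝ) - 1) = 1 := by
      norm_num
    rw [this, div_le_iff₀ (by norm_num; exact hl0)]
    norm_num
    linarith
  · have : 3 / 2 ≤ Real.logb 2 (((4 : ℕ) : ℝ) - 1) := by
      have h9 : (3 : ℝ) ≤ Real.logb 2 9 := by
        rw [Real.le_logb_iff_rpow_le (by norm_num) (by norm_num)]
        norm_num
      have : Real.logb 2 9 = 2 * Real.logb 2 3 := by
        rw [show (9 : ℝ) = 3 ^ 2 by norm_num, Real.logb_pow]; norm_num
      norm_num
      linarith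
    refine le_trans ?_ (mul_le_mul_of_nonneg_left (add_le_add_left this _) (by norm_num))
    rw [div_le_iff₀ (by norm_num; exact hl0)]
    norm_num
    linarith
  · have h5' : (5 : ℝ) ≤ n := by exact_mod_cast h5
    have h2 : 2 ≤ Real.logb 2 ((n : ℝ) - 1) := by
      rw [Real.le_logb_iff_rpow_le (by norm_num) (by linarith)]
      norm_num
      linarith
    have h1 : 1 ≤ (n : ℝ) / ((n : ℝ) - 1) := by
      rw [le_div_iff₀ (by linarith)]; linarith
    have h3 : ((n : ℝ) - 2) * (n : ℝ) / (((n : ℝ) - 1) ^ 2 * Real.log 2) ≤ 3 / 2 := by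
      have hp : 0 < ((n : ℝ) - 1) ^ 2 := by
        have : 0 < (n : ℝ) - 1 := by linarith
        positivity
      rw [div_le_iff₀ (mul_pos hp hl0)]
      nlinarith
    linarith

/-- For the complete graph `Kₙ`, the compressing information is at most
`(1/2)(log₂(n−1) + n/(n−1))`, hence at most `(1/2)log₂ n + 1`: at least roughly half
of the Shannon entropy `log₂ n` cannot be decoded by any encoding tree. -/
theorem stmt11 {V : Type} [Fintype V] [DecidableEq V]
    (n : ℕ) (hn : 2 ≤ n) (hcard : Fintype.card V = n) :
    SiLeM.CInfo (⊤ : SimpleGraph V) ≤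
        (1 / 2) * (Real.logb 2 ((n : ℝ) - 1) + (n : ℝ) / ((n : ℝ) - 1)) ∧
    SiLeM.CInfo (⊤ : SimpleGraph V) ≤ (1 / 2) * Real.logb 2 (n : ℝ) + 1 := by
  subst hcard
  have h2 : (2 : ℝ) ≤ Fintype.card V := by exact_mod_cast hn
  have hnum := s11_num (Fintype.card V) hn
  have hb : 0 ≤ ((Fintype.card V : ℝ) - 2) * (Fintype.card V : ℝ) /
        (((Fintype.card V : ℝ) - 1) ^ 2 * Real.log 2) := by
    have : 0 ≤ (Fintype.card V : ℝ) - 2 := by linarith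
    have := Real.log_pos (show (1 : ℝ) < 2 by norm_num)
    positivity
  have key : SiLeM.CInfo (⊤ : SimpleGraph V) ≤
      (1 / 2) * (Real.logb 2 ((Fintype.card V : ℝ) - 1) +
        (Fintype.card V : ℝ) / ((Fintype.card V : ℝ) - 1)) := by
    refine le_trans ?_ hnum
    apply Real.sSup_le _ hb
    rintro x ⟨T, rfl⟩
    exact s11_CT hn T
  refine ⟨key, key.trans ?_⟩
  have h3 : Real.logb 2 ((Fintype.card V : ℝ) - 1) ≤ Real.logb 2 (Fintype.card V : ℝ) :=
    Real.logb_le_logb_of_le (by norm_num) (by linarith) (by linarith)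
  have h4 : (Fintype.card V : ℝ) / ((Fintype.card V : ℝ) - 1) ≤ 2 := by
    rw [div_le_iff₀ (by linarith)]; linarith
  linarith
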